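/- Let α ≥ 1/2, θ₀ ∈ ℝ, and let Δ : (0,1) → [0,∞) satisfy Δ(γ)/(log(1/(1−γ)))^{1/α} → 0 as γ → 1⁻. Then for every constant c₀ > 0 there exists γ₀ ∈ (0,1) such that for every γ ∈ [γ₀,1): exp((1−c₀)·h_{θ₀}(S*(θ₀,γ))·Δ(γ)) ≤ P_{θ₀}(S*(θ₀,γ))/P_{θ₀}(S*(θ₀,γ)+Δ(γ)) ≤ exp((1+c₀)·h_{θ₀}(S*(θ₀,γ))·Δ(γ)). -/

import Mathlib

open MeasureTheory Filter Set Topology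

/-- Normalization constant `C₀ = (∫ exp(-|x|^α) dx)⁻¹`. -/
noncomputable def C0 (α : ℝ) : ℝ := (∫ x : ℝ, Real.exp (-(|x| ^ α)))⁻¹

/-- Density `f_θ(x) = C₀ exp(-|x-θ|^α)`. -/
noncomputable def fd (α θ x : ℝ) : ℝ := C0 α * Real.exp (-(|x - θ| ^ α))

/-- Tail probability `P_θ(S) = ∫_S^∞ f_θ(x) dx`. -/
noncomputable def Ptail (α θ S : ℝ) : ℝ := ∫ x in Set.Ioi S, fd α θ x

/-- Conditional mean above `S`: `μ_θ(S) = (∫_S^∞ x f_θ(x) dx) / P_θ(S)`. -/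
noncomputable def muTail (α θ S : ℝ) : ℝ := (∫ x in Set.Ioi S, x * fd α θ x) / Ptail α θ S

/-- `g_θ(S) = P_θ(S) / ∫_S^∞ P_θ(x) dx`. -/
noncomputable def gfun (α θ S : ℝ) : ℝ := Ptail α θ S / ∫ x in Set.Ioi S, Ptail α θ x

/-- Hazard rate `h_θ(S) = f_θ(S)/P_θ(S)`. -/
noncomputable def hazard (α θ S : ℝ) : ℝ := fd α θ S / Ptail α θ S

lemma integrable_exp_neg_abs_rpow {α : ℝ} (hα : 0 < α) :
    Integrable (fun x : ℝ => Real.exp (-(|x| ^ α))) ∧ 0 < ∫ x : ℝ, Real.exp (-(|x| ^ α)) := by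
  have h : 0 < ∫ x : ℝ, Real.exp (-(|x| ^ α)) := by
    rw [integral_comp_abs (f := fun x => Real.exp (-(x ^ α))), integral_exp_neg_rpow hα]
    have := Real.Gamma_pos_of_pos (s := 1 / α + 1) (by positivity)
    positivity
  exact ⟨by_contra fun hn => h.ne' (integral_undef hn), h⟩

lemma C0_pos {α : ℝ} (hα : 0 < α) : 0 < C0 α :=
  inv_pos.2 (integrable_exp_neg_abs_rpow hα).2

lemma fd_pos {α : ℝ} (hα : 0 < α) (θ x : ℝ) : 0 < fd α θ x :=
  mul_pos (C0_pos hα) (Real.exp_pos _)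

lemma continuous_fd {α : ℝ} (hα : 0 < α) (θ : ℝ) : Continuous (fd α θ) := by
  have : Continuous fun x : ℝ => |x - θ| ^ α :=
    (by fun_prop : Continuous fun x : ℝ => |x - θ|).rpow_const fun _ => Or.inr hα.le
  unfold fd
  fun_prop

lemma integrable_fd {α : ℝ} (hα : 0 < α) (θ : ℝ) : Integrable (fd α θ) :=
  ((integrable_exp_neg_abs_rpow hα).1.comp_sub_right θ).const_mul _

lemma Ptail_sub_Ptail {α : ℝ} (hα : 0 < α) (θ a b : ℝ) :
    Ptail α θ a - Ptail α θ b = ∫ x in a..b, fd α θ x :=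
  intervalIntegral.integral_Ioi_sub_Ioi' (integrable_fd hα θ).integrableOn
    (integrable_fd hα θ).integrableOn

lemma Ptail_nonneg {α : ℝ} (hα : 0 < α) (θ S : ℝ) : 0 ≤ Ptail α θ S :=
  setIntegral_nonneg measurableSet_Ioi fun x _ => (fd_pos hα θ x).le

lemma strictAnti_Ptail {α : ℝ} (hα : 0 < α) (θ : ℝ) : StrictAnti (Ptail α θ) := by
  intro a b hab
  rw [← sub_pos, Ptail_sub_Ptail hα]
  exact intervalIntegral.intervalIntegral_pos_of_pos
    ((continuous_fd hα θ).intervalIntegrable _ _) (fd_pos hα θ) hab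

lemma Ptail_pos {α : ℝ} (hα : 0 < α) (θ S : ℝ) : 0 < Ptail α θ S :=
  (Ptail_nonneg hα θ (S + 1)).trans_lt (strictAnti_Ptail hα θ (lt_add_one S))

lemma hasDerivAt_Ptail {α : ℝ} (hα : 0 < α) (θ S : ℝ) :
    HasDerivAt (Ptail α θ) (-fd α θ S) S := by
  have h : Ptail α θ = fun x => Ptail α θ 0 - ∫ t in (0 : ℝ)..x, fd α θ t := by
    funext x
    rw [← Ptail_sub_Ptail hα]
    ring
  rw [h]
  exact ((continuous_fd hα θ).integral_hasStrictDerivAt 0 S).hasDerivAt.const_sub _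

lemma tendsto_Ptail_atTop {α : ℝ} (hα : 0 < α) (θ : ℝ) :
    Tendsto (Ptail α θ) atTop (𝓝 0) := by
  have h := (intervalIntegral_tendsto_integral_Ioi (0 : ℝ) (integrable_fd hα θ).integrableOn
    tendsto_id).const_sub (Ptail α θ 0)
  rw [show Ptail α θ 0 - ∫ x in Ioi (0 : ℝ), fd α θ x = 0 from sub_self _] at h
  refine h.congr fun x => ?_
  simp only [id, ← Ptail_sub_Ptail hα]
  ring

lemma hazard_pos {α : ℝ} (hα : 0 < α) (θ S : ℝ) : 0 < hazard α θ S :=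
  div_pos (fd_pos hα θ S) (Ptail_pos hα θ S)

/-- The ratio of tail probabilities is the exponential of the hazard rate at an intermediate point
times the shift. -/
lemma exists_Ptail_div_eq_exp {α : ℝ} (hα : 0 < α) (θ S : ℝ) {d : ℝ} (hd : 0 ≤ d) :
    ∃ t ∈ Icc S (S + d), Ptail α θ S / Ptail α θ (S + d) = Real.exp (hazard α θ t * d) := by
  have hP := Ptail_pos hα θ
  rcases hd.eq_or_lt with rfl | hd
  · exact ⟨S, by simp, by simp [(hP S).ne']⟩
  have hder (x : ℝ) :
      HasDerivAt (fun y => Real.log (Ptail α θ y)) (-fd α θ x / Ptail α θ x) x :=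
    (hasDerivAt_Ptail hα θ x).log (hP x).ne'
  obtain ⟨t, ht, h⟩ := exists_hasDerivAt_eq_slope _ _ (lt_add_of_pos_right S hd)
    (fun x _ => (hder x).continuousAt.continuousWithinAt) fun x _ => hder x
  refine ⟨t, Ioo_subset_Icc_self ht, ?_⟩
  rw [← Real.exp_log (div_pos (hP S) (hP (S + d))), Real.log_div (hP _).ne' (hP _).ne']
  congr 1
  have : hazard α θ t = -(-fd α θ t / Ptail α θ t) := by rw [hazard]; ring
  rw [this, h, add_sub_cancel_left]
  field_simp
  ring

/-- The hazard rate is asymptotically equivalent to `α (t - θ) ^ (α - 1)`. -/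
lemma tendsto_hazard_div_rpow {α : ℝ} (hα : 0 < α) (θ : ℝ) :
    Tendsto (fun t => hazard α θ t / (t - θ) ^ (α - 1)) atTop (𝓝 α) := by
  have hu : Tendsto (fun t : ℝ => t - θ) atTop atTop := tendsto_atTop_add_const_right _ _ tendsto_id
  have hpos : ∀ᶠ t : ℝ in atTop, 0 < t - θ := hu.eventually_gt_atTop 0
  have hlim : Tendsto (fun t : ℝ => -α + (1 - α) * (t - θ) ^ (-α)) atTop (𝓝 (-α)) := by
    simpa using (((tendsto_rpow_neg_atTop hα).comp hu).const_mul (1 - α)).const_add (-α)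
  have hg : ∀ᶠ t in atTop, HasDerivAt (fun t => fd α θ t * (t - θ) ^ (1 - α))
      (fd α θ t * (-α + (1 - α) * (t - θ) ^ (-α))) t := by
    filter_upwards [hpos] with t ht
    have hid : HasDerivAt (fun t : ℝ => t - θ) 1 t := (hasDerivAt_id t).sub_const θ
    have hf : HasDerivAt (fd α θ)
        (C0 α * (Real.exp (-((t - θ) ^ α)) * -(1 * α * (t - θ) ^ (α - 1)))) t := by
      refine ((hid.rpow_const (p := α) (Or.inl ht.ne')).fun_neg.exp.const_mul
        (C0 α)).congr_of_eventuallyEq ?_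
      filter_upwards [lt_mem_nhds (show θ < t by linarith)] with x hx
      rw [fd, abs_of_pos (sub_pos.2 hx)]
    refine (hf.fun_mul (hid.rpow_const (p := 1 - α) (Or.inl ht.ne'))).congr_deriv ?_
    have h1 : (t - θ) ^ (α - 1) * (t - θ) ^ (1 - α) = 1 := by
      rw [← Real.rpow_add ht]; simp
    rw [fd, abs_of_pos ht, show 1 - α - 1 = -α by ring]
    linear_combination -(C0 α * Real.exp (-((t - θ) ^ α)) * α) * h1
  have hg0 : Tendsto (fun t => fd α θ t * (t - θ) ^ (1 - α)) atTop (𝓝 0) := by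
    have h := ((tendsto_rpow_mul_exp_neg_mul_atTop_nhds_zero ((1 - α) / α) 1 one_pos).comp
      ((tendsto_rpow_atTop hα).comp hu)).const_mul (C0 α)
    rw [mul_zero] at h
    refine h.congr' ?_
    filter_upwards [hpos] with t ht
    simp only [Function.comp_apply]
    rw [fd, abs_of_pos ht, ← Real.rpow_mul ht.le, mul_div_cancel₀ _ hα.ne', neg_one_mul]
    ring
  have hL : Tendsto (fun t => Ptail α θ t / (fd α θ t * (t - θ) ^ (1 - α))) atTop (𝓝 α⁻¹) := by
    refine HasDerivAt.lhopital_zero_atTop (.of_forall (hasDerivAt_Ptail hα θ)) hg ?_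
      (tendsto_Ptail_atTop hα θ) hg0 ?_
    · filter_upwards [hlim.eventually_ne (neg_ne_zero.2 hα.ne')] with t ht
      exact mul_ne_zero (fd_pos hα θ t).ne' ht
    · have h := (hlim.inv₀ (neg_ne_zero.2 hα.ne')).neg
      rw [inv_neg, neg_neg] at h
      refine h.congr fun t => ?_
      rw [neg_div, div_mul_cancel_left₀ (fd_pos hα θ t).ne']
  have h := hL.inv₀ (inv_ne_zero hα.ne')
  rw [inv_inv] at h
  refine h.congr' ?_
  filter_upwards [hpos] with t ht
  rw [hazard, show 1 - α = -(α - 1) by ring, Real.rpow_neg ht.le, inv_div]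
  field_simp

/-- The hazard rate is slowly varying under relatively small shifts. -/
lemma tendsto_hazard_div_hazard {α : ℝ} (hα : 0 < α) (θ : ℝ) {ι : Type*} {l : Filter ι}
    {S t d : ι → ℝ} (hS : Tendsto S l atTop) (hd : Tendsto (fun i => d i / S i) l (𝓝 0))
    (ht : ∀ i, t i ∈ Icc (S i) (S i + d i)) :
    Tendsto (fun i => hazard α θ (t i) / hazard α θ (S i)) l (𝓝 1) := by
  have htop : Tendsto t l atTop := tendsto_atTop_mono (fun i => (ht i).1) hS
  have hr : Tendsto (fun i => (t i - θ) / (S i - θ)) l (𝓝 1) := by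
    have hinv : Tendsto (fun i => θ / S i) l (𝓝 0) := hS.const_div_atTop θ
    have htS : Tendsto (fun i => t i / S i) l (𝓝 1) := by
      refine tendsto_of_tendsto_of_tendsto_of_le_of_le' tendsto_const_nhds
        (by simpa using hd.const_add 1) ?_ ?_
      · filter_upwards [hS.eventually_gt_atTop 0] with i hi
        exact (one_le_div hi).2 (ht i).1
      · filter_upwards [hS.eventually_gt_atTop 0] with i hi
        rw [div_le_iff₀ hi, add_mul, div_mul_cancel₀ _ hi.ne', one_mul]
        exact (ht i).2
    have h := (htS.sub hinv).div (hinv.const_sub 1) (by simp)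
    simp only [sub_zero, div_one] at h
    refine h.congr' ?_
    filter_upwards [hS.eventually_gt_atTop 0, hS.eventually_gt_atTop θ] with i hi hi'
    have : S i - θ ≠ 0 := (sub_pos.2 hi').ne'
    simp only [Pi.div_apply]
    rw [← sub_div, one_sub_div hi.ne', div_div_div_cancel_right₀ hi.ne']
  have hφ := tendsto_hazard_div_rpow hα θ
  have h := ((hφ.comp htop).div (hφ.comp hS) hα.ne').mul
    (hr.rpow_const (p := α - 1) (Or.inl one_ne_zero))
  rw [div_self hα.ne', Real.one_rpow, mul_one] at h
  refine h.congr' ?_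
  filter_upwards [hS.eventually_gt_atTop θ, htop.eventually_gt_atTop θ] with i hi hi'
  have h1 := Real.rpow_pos_of_pos (sub_pos.2 hi) (α - 1)
  have h2 := Real.rpow_pos_of_pos (sub_pos.2 hi') (α - 1)
  have h3 := hazard_pos hα θ (S i)
  simp only [Pi.div_apply, Function.comp_apply]
  rw [Real.div_rpow (sub_pos.2 hi').le (sub_pos.2 hi).le]
  field_simp

/-- A solution of the Bellman equation dominates the tail probability one unit further. -/
lemma Ptail_add_one_le_of_bellman {α : ℝ} (hα : 0 < α) {θ S c : ℝ} (hc : 0 < c) (hS : 0 < S)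
    (h : c * S = ∫ x in Ioi S, Ptail α θ x) : Ptail α θ (S + 1) ≤ c * S := by
  have hint : IntegrableOn (Ptail α θ) (Ioi S) := by
    by_contra hn
    exact (mul_pos hc hS).ne' (h.trans (integral_undef hn))
  rw [h]
  calc Ptail α θ (S + 1) = ∫ _ in Ioc S (S + 1), Ptail α θ (S + 1) := by simp
    _ ≤ ∫ x in Ioc S (S + 1), Ptail α θ x :=
      setIntegral_mono_on (by simp) (hint.mono_set Ioc_subset_Ioi_self) measurableSet_Ioc
        fun x hx => (strictAnti_Ptail hα θ).antitone hx.2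
    _ ≤ ∫ x in Ioi S, Ptail α θ x :=
      setIntegral_mono_set hint (.of_forall (Ptail_nonneg hα θ)) Ioc_subset_Ioi_self.eventuallyLE

lemma fd_add_one_le_Ptail {α : ℝ} (hα : 0 < α) {θ S : ℝ} (hS : θ ≤ S) :
    fd α θ (S + 1) ≤ Ptail α θ S := by
  calc fd α θ (S + 1) = ∫ _ in Ioc S (S + 1), fd α θ (S + 1) := by simp
    _ ≤ ∫ x in Ioc S (S + 1), fd α θ x := by
      refine setIntegral_mono_on (by simp) (integrable_fd hα θ).integrableOn measurableSet_Ioc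
        fun x hx => ?_
      refine mul_le_mul_of_nonneg_left (Real.exp_le_exp.2 (neg_le_neg ?_)) (C0_pos hα).le
      have hx0 : 0 ≤ x - θ := by linarith [hx.1]
      rw [abs_of_nonneg hx0, abs_of_nonneg (by linarith [hx.2])]
      exact Real.rpow_le_rpow hx0 (by linarith [hx.2]) hα.le
    _ ≤ Ptail α θ S :=
      setIntegral_mono_set (integrable_fd hα θ).integrableOn
        (.of_forall fun x => (fd_pos hα θ x).le) Ioc_subset_Ioi_self.eventuallyLE

/-- Solutions of the Bellman equation tend to infinity as the discount factor tends to one. -/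
lemma tendsto_atTop_of_bellman {α : ℝ} (hα : 0 < α) {θ : ℝ} {S : ℝ → ℝ}
    (hS : ∀ γ ∈ Ioo (0 : ℝ) 1, 0 < S γ ∧ Ptail α θ (S γ + 1) ≤ (1 - γ) / γ * S γ) :
    Tendsto S (𝓝[<] 1) atTop := by
  refine tendsto_atTop.2 fun M => ?_
  have h0 : Tendsto (fun γ : ℝ => (1 - γ) / γ * M) (𝓝[<] 1) (𝓝 0) := by
    have : ContinuousAt (fun γ : ℝ => (1 - γ) / γ * M) 1 := by fun_prop (disch := simp)
    simpa [ContinuousAt] using this.tendsto.mono_left nhdsWithin_le_nhds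
  filter_upwards [Ioo_mem_nhdsLT one_pos, h0.eventually_lt_const (Ptail_pos hα θ (M + 1))]
    with γ hγ hlt
  by_contra! hM
  have h1 := (hS γ hγ).2
  have h2 : Ptail α θ (M + 1) ≤ Ptail α θ (S γ + 1) :=
    (strictAnti_Ptail hα θ).antitone (by linarith)
  have h3 : (1 - γ) / γ * S γ ≤ (1 - γ) / γ * M :=
    mul_le_mul_of_nonneg_left hM.le (div_nonneg (by linarith [hγ.2]) hγ.1.le)
  linarith

/-- Growth rate of solutions of the Bellman equation as the discount factor tends to one. -/
lemma eventually_log_rpow_le_of_bellman {α : ℝ} (hα : 0 < α) {θ : ℝ} {S : ℝ → ℝ}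
    (hS : ∀ γ ∈ Ioo (0 : ℝ) 1, 0 < S γ ∧ Ptail α θ (S γ + 1) ≤ (1 - γ) / γ * S γ) :
    ∀ᶠ γ in 𝓝[<] (1 : ℝ),
      Real.log (1 / (1 - γ)) ^ (1 / α) ≤ (1 + 2 ^ α) ^ (1 / α) * S γ := by
  have htop := tendsto_atTop_of_bellman hα hS
  have hlog : ∀ᶠ s : ℝ in atTop, Real.log 2 + Real.log s - Real.log (C0 α) ≤ s ^ α := by
    have h1 := (isLittleO_log_rpow_atTop hα).bound (show (0 : ℝ) < 1 / 2 by norm_num)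
    filter_upwards [h1, eventually_ge_atTop 0, (tendsto_rpow_atTop hα).eventually_ge_atTop
      (2 * (Real.log 2 - Real.log (C0 α)))] with s hs hs0 hs1
    rw [Real.norm_of_nonneg (Real.rpow_nonneg hs0 α)] at hs
    linarith [(Real.le_norm_self _).trans hs]
  filter_upwards [Ioo_mem_nhdsLT (show (1 / 2 : ℝ) < 1 by norm_num), htop.eventually hlog,
    htop.eventually_ge_atTop (2 - θ), htop.eventually_ge_atTop (θ - 1)] with γ hγ hl h2 hθ
  obtain ⟨hs, hb⟩ := hS γ ⟨by linarith [hγ.1], hγ.2⟩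
  have hγ1 : 0 < 1 - γ := by linarith [hγ.2]
  have hf := (fd_add_one_le_Ptail hα (θ := θ) (S := S γ + 1) (by linarith)).trans hb
  have hle : (1 - γ) / γ * S γ ≤ 2 * (1 - γ) * S γ := by
    refine mul_le_mul_of_nonneg_right ?_ hs.le
    rw [div_le_iff₀ (by linarith [hγ.1])]
    nlinarith [hγ.1]
  have hpow : |S γ + 1 + 1 - θ| ^ α ≤ 2 ^ α * S γ ^ α := by
    rw [← Real.mul_rpow (by norm_num) hs.le, abs_of_nonneg (by linarith)]
    exact Real.rpow_le_rpow (by linarith) (by linarith) hα.le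
  have hmain := Real.log_le_log (fd_pos hα θ _) (hf.trans hle)
  rw [fd, Real.log_mul (C0_pos hα).ne' (Real.exp_ne_zero _), Real.log_exp,
    Real.log_mul (by positivity) hs.ne', Real.log_mul two_ne_zero hγ1.ne'] at hmain
  have hL : Real.log (1 / (1 - γ)) ≤ (1 + 2 ^ α) * S γ ^ α := by
    rw [one_div, Real.log_inv]
    linarith
  have hL0 : 0 ≤ Real.log (1 / (1 - γ)) :=
    Real.log_nonneg ((one_le_div hγ1).2 (by linarith [hγ.1]))
  refine (Real.rpow_le_rpow hL0 hL (by positivity)).trans_eq ?_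
  rw [Real.mul_rpow (by positivity) (by positivity), ← Real.rpow_mul hs.le,
    mul_one_div_cancel hα.ne', Real.rpow_one]

/-- First-order approximation of the tail-probability ratio at a shifted threshold:
`exp((1∓c₀)·h_{θ₀}(S*)·Δ(γ)) ≤ P_{θ₀}(S*)/P_{θ₀}(S*+Δ(γ)) ≤ exp((1±c₀)·h_{θ₀}(S*)·Δ(γ))`
eventually in `γ`. -/
theorem stmt_12 (α : ℝ) (hα : 1/2 ≤ α) (θ₀ : ℝ)
    (Sstar : ℝ → ℝ → ℝ)
    (hS : ∀ θ : ℝ, ∀ γ ∈ Set.Ioo (0:ℝ) 1,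
      0 < Sstar θ γ ∧
      ((1-γ)/γ) * Sstar θ γ = (∫ x in Set.Ioi (Sstar θ γ), Ptail α θ x) ∧
      ∀ S, 0 < S → ((1-γ)/γ) * S = (∫ x in Set.Ioi S, Ptail α θ x) → S = Sstar θ γ)
    (Δ : ℝ → ℝ) (hΔ0 : ∀ γ, 0 ≤ Δ γ)
    (hΔ : Tendsto (fun γ => Δ γ / (Real.log (1/(1-γ))) ^ (1/α)) (𝓝[<] (1:ℝ)) (𝓝 0)) :
    ∀ c₀ > 0, ∃ γ₀ ∈ Set.Ioo (0:ℝ) 1, ∀ γ, γ₀ ≤ γ → γ < 1 →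
      Real.exp ((1 - c₀) * hazard α θ₀ (Sstar θ₀ γ) * Δ γ) ≤
        Ptail α θ₀ (Sstar θ₀ γ) / Ptail α θ₀ (Sstar θ₀ γ + Δ γ) ∧
      Ptail α θ₀ (Sstar θ₀ γ) / Ptail α θ₀ (Sstar θ₀ γ + Δ γ) ≤
        Real.exp ((1 + c₀) * hazard α θ₀ (Sstar θ₀ γ) * Δ γ) := by
  have hα0 : 0 < α := by linarith
  have hb : ∀ γ ∈ Ioo (0 : ℝ) 1, 0 < Sstar θ₀ γ ∧
      Ptail α θ₀ (Sstar θ₀ γ + 1) ≤ (1 - γ) / γ * Sstar θ₀ γ := fun γ hγ =>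
    ⟨(hS θ₀ γ hγ).1, Ptail_add_one_le_of_bellman hα0 (div_pos (by linarith [hγ.2]) hγ.1)
      (hS θ₀ γ hγ).1 (hS θ₀ γ hγ).2.1⟩
  have htop := tendsto_atTop_of_bellman hα0 hb
  have hlim := hΔ.mul_const ((1 + 2 ^ α) ^ (1 / α))
  rw [zero_mul] at hlim
  have hΔS : Tendsto (fun γ => Δ γ / Sstar θ₀ γ) (𝓝[<] 1) (𝓝 0) := by
    refine tendsto_of_tendsto_of_tendsto_of_le_of_le' tendsto_const_nhds hlim ?_ ?_
    · filter_upwards [htop.eventually_gt_atTop 0] with γ hγ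
      exact div_nonneg (hΔ0 γ) hγ.le
    · filter_upwards [htop.eventually_gt_atTop 0, eventually_log_rpow_le_of_bellman hα0 hb,
        Ioo_mem_nhdsLT one_pos] with γ hs hle hγ
      have hL : 0 < Real.log (1 / (1 - γ)) ^ (1 / α) :=
        Real.rpow_pos_of_pos (Real.log_pos ((one_lt_div (by linarith [hγ.2])).2
          (by linarith [hγ.1]))) _
      rw [div_mul_eq_mul_div, div_le_div_iff₀ hs hL, mul_assoc]
      exact mul_le_mul_of_nonneg_left hle (hΔ0 γ)
  choose t ht hexp using fun γ => exists_Ptail_div_eq_exp hα0 θ₀ (Sstar θ₀ γ) (hΔ0 γ)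
  have hratio := tendsto_hazard_div_hazard hα0 θ₀ htop hΔS ht
  intro c₀ hc₀
  have hev : ∀ᶠ γ in 𝓝[<] (1 : ℝ),
      1 - c₀ < hazard α θ₀ (t γ) / hazard α θ₀ (Sstar θ₀ γ) ∧
      hazard α θ₀ (t γ) / hazard α θ₀ (Sstar θ₀ γ) < 1 + c₀ :=
    (hratio.eventually_const_lt (by linarith)).and (hratio.eventually_lt_const (by linarith))
  obtain ⟨a, ha, hsub⟩ := mem_nhdsLT_iff_exists_Ico_subset.1
    (hev.and (Ioo_mem_nhdsLT one_pos))
  have ha' := hsub ⟨le_rfl, ha⟩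
  refine ⟨a, ha'.2, fun γ hγ hγ1 => ?_⟩
  obtain ⟨h1, h2⟩ := (hsub ⟨hγ, hγ1⟩).1
  have hh := hazard_pos hα0 θ₀ (Sstar θ₀ γ)
  rw [lt_div_iff₀ hh] at h1
  rw [div_lt_iff₀ hh] at h2
  rw [hexp γ]
  exact ⟨Real.exp_le_exp.2 (mul_le_mul_of_nonneg_right h1.le (hΔ0 γ)),
    Real.exp_le_exp.2 (mul_le_mul_of_nonneg_right h2.le (hΔ0 γ))⟩
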